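/- Let P be a string with run-length encoding rle(P) = ⟨(c_0,l_0),…,(c_{ρ-1},l_{ρ-1})⟩ and let S be a string with run-length encoding of length at least j+2, for some j ≥ 0. Then, for every i with 2 ≤ i ≤ ρ−1, the prefix P[0..α_P(i)−1] of P of length α_P(i) is a suffix of S[0..α_S(j+1)−1] if and only if all three of the following hold: (1) the prefix P[0..α_P(i−1)−1] of P of length α_P(i−1) is a suffix of S[0..α_S(j)−1]; (2) S[α_S(j)] = c_{i−1}; and (3) ℓ_S(j) = l_{i−1}. (This is case (a) of the paper's Lemma 3, expressing one run-wise transition of the nondeterministic KMP automaton for an interior run of P.) -/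

import Mathlib

/-- Decoding of a run-length encoding: concatenation of the runs. -/
def decodeRLE {α : Type*} (r : List (α × ℕ)) : List α :=
  r.foldr (fun p acc => List.replicate p.2 p.1 ++ acc) []

/-- `IsRLE r S` : `r` is the run-length encoding of `S`
    (all run lengths are ≥ 1, adjacent runs have distinct symbols, decoding gives `S`). -/
def IsRLE {α : Type*} (r : List (α × ℕ)) (S : List α) : Prop :=
  (∀ p ∈ r, 1 ≤ p.2) ∧ List.Chain' (fun p q => p.1 ≠ q.1) r ∧ decodeRLE r = S

/-- `rleStart r k` = α(k), the starting position of run `k` (sum of lengths of runs before `k`). -/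
def rleStart {α : Type*} (r : List (α × ℕ)) (k : ℕ) : ℕ :=
  ((r.take k).map Prod.snd).sum

theorem decodeRLE_append {α : Type*} (r s : List (α × ℕ)) :
    decodeRLE (r ++ s) = decodeRLE r ++ decodeRLE s := by
  induction r with
  | nil => rfl
  | cons p r ih =>
    simp only [decodeRLE, List.cons_append, List.foldr_cons, List.append_assoc] at ih ⊢
    rw [ih]

theorem decodeRLE_singleton {α : Type*} (p : α × ℕ) :
    decodeRLE [p] = List.replicate p.2 p.1 := by
  simp [decodeRLE]

theorem length_decodeRLE {α : Type*} (r : List (α × ℕ)) :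
    (decodeRLE r).length = (r.map Prod.snd).sum := by
  induction r with
  | nil => rfl
  | cons p r ih =>
    simp only [decodeRLE, List.foldr_cons, List.length_append, List.length_replicate,
      List.map_cons, List.sum_cons] at ih ⊢
    rw [ih]

theorem take_rleStart_decodeRLE {α : Type*} (r : List (α × ℕ)) (k : ℕ) :
    (decodeRLE r).take (rleStart r k) = decodeRLE (r.take k) := by
  conv_lhs => rw [← List.take_append_drop k r, decodeRLE_append, List.take_append_drop]
  rw [rleStart, ← length_decodeRLE, List.take_left]

theorem decodeRLE_take_succ {α : Type*} (r : List (α × ℕ)) (k : ℕ) (hk : k < r.length) :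
    decodeRLE (r.take (k + 1)) = decodeRLE (r.take k) ++ List.replicate r[k].2 r[k].1 := by
  rw [← List.take_concat_get' r k hk, decodeRLE_append, decodeRLE_singleton]

theorem getLast?_decodeRLE_take_succ {α : Type*} (r : List (α × ℕ)) (k : ℕ) (hk : k < r.length)
    (hr : ∀ p ∈ r, 1 ≤ p.2) : (decodeRLE (r.take (k + 1))).getLast? = some r[k].1 := by
  have h := hr _ (List.getElem_mem hk)
  rw [decodeRLE_take_succ r k hk, List.getLast?_append, List.getLast?_replicate,
    if_neg (by omega)]
  rfl

theorem getD_decodeRLE_rleStart {α : Type*} (r : List (α × ℕ)) (k : ℕ) (hk : k < r.length)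
    (hr : ∀ p ∈ r, 1 ≤ p.2) (d : α) : (decodeRLE r).getD (rleStart r k) d = r[k].1 := by
  have h := hr _ (List.getElem_mem hk)
  have e : decodeRLE r =
      decodeRLE (r.take k) ++ (List.replicate r[k].2 r[k].1 ++ decodeRLE (r.drop (k + 1))) := by
    rw [← List.append_assoc, ← decodeRLE_take_succ, ← decodeRLE_append, List.take_append_drop]
  rw [e, rleStart, ← length_decodeRLE, List.getD_append_right _ _ _ _ le_rfl, Nat.sub_self,
    List.getD_append _ _ _ _ (by rw [List.length_replicate]; omega), List.getD_replicate _ (by omega)]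

/-- The symbol preceding a run differs from the symbol of that run. -/
theorem ne_of_mem_getLast?_decodeRLE_take {α : Type*} {r : List (α × ℕ)} {S : List α}
    (h : IsRLE r S) (k : ℕ) (hk : k < r.length) :
    ∀ x ∈ (decodeRLE (r.take k)).getLast?, x ≠ r[k].1 := by
  cases k with
  | zero => simp [decodeRLE]
  | succ k =>
    rw [getLast?_decodeRLE_take_succ r k (by omega) h.1]
    rintro x ⟨⟩
    exact List.isChain_iff_getElem.1 h.2.1 k hk

theorem replicate_append_prefix_replicate_append_iff {α : Type*} {c : α} {A B : List α}
    (hB : B ≠ []) (hBc : ∀ x ∈ B.head?, x ≠ c) (hAc : ∀ x ∈ A.head?, x ≠ c) (l m : ℕ) :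
    List.replicate m c ++ B <+: List.replicate l c ++ A ↔ B <+: A ∧ l = m := by
  induction m generalizing l with
  | zero =>
    cases l with
    | zero => simp
    | succ l =>
      cases B with
      | nil => exact absurd rfl hB
      | cons b B =>
        have : b ≠ c := hBc b rfl
        simp [List.replicate_succ, this]
  | succ m ih =>
    cases l with
    | zero =>
      cases A with
      | nil => simp [List.replicate_succ]
      | cons a A =>
        have : a ≠ c := hAc a rfl
        simp [List.replicate_succ, this.symm]
    | succ l => simp [List.replicate_succ, ih]

theorem append_replicate_suffix_append_replicate_iff {α : Type*} {c d : α} {A B : List α}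
    (hB : B ≠ []) (hBd : ∀ x ∈ B.getLast?, x ≠ d) (hAc : ∀ x ∈ A.getLast?, x ≠ c)
    {l m : ℕ} (hl : 1 ≤ l) (hm : 1 ≤ m) :
    B ++ List.replicate m d <:+ A ++ List.replicate l c ↔ B <:+ A ∧ c = d ∧ l = m := by
  by_cases hcd : c = d
  · subst hcd
    have h := replicate_append_prefix_replicate_append_iff (c := c) (A := A.reverse)
      (B := B.reverse) (by simpa using hB) (by simpa using hBd) (by simpa using hAc) l m
    rw [← List.reverse_prefix]
    simpa using h
  · obtain ⟨l, rfl⟩ := Nat.exists_eq_add_of_le' hl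
    obtain ⟨m, rfl⟩ := Nat.exists_eq_add_of_le' hm
    rw [← List.reverse_prefix]
    rw [List.reverse_append, List.reverse_append, List.reverse_replicate, List.reverse_replicate]
    simp [List.replicate_succ, Ne.symm hcd, hcd]

theorem stmt_4 {α : Type*} [Fintype α] [Inhabited α] (P S : List α) (rP rS : List (α × ℕ))
    (hP : IsRLE rP P) (hS : IsRLE rS S)
    (j : ℕ) (hj : j + 2 ≤ rS.length)
    (i : ℕ) (hi1 : 2 ≤ i) (hi2 : i ≤ rP.length - 1) :
    (P.take (rleStart rP i) <:+ S.take (rleStart rS (j + 1))) ↔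
      ((P.take (rleStart rP (i - 1)) <:+ S.take (rleStart rS j)) ∧
       S.getD (rleStart rS j) default = (rP[i - 1]'(by omega)).1 ∧
       (rS[j]'(by omega)).2 = (rP[i - 1]'(by omega)).2) := by
  obtain ⟨k, rfl⟩ : ∃ k, i = k + 1 + 1 := ⟨i - 2, by omega⟩
  have hP_last := getLast?_decodeRLE_take_succ rP k (by omega) hP.1
  have hP_ne := ne_of_mem_getLast?_decodeRLE_take hP (k + 1) (by omega)
  have hS_ne := ne_of_mem_getLast?_decodeRLE_take hS j (by omega)
  obtain rfl := hP.2.2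
  obtain rfl := hS.2.2
  simp only [Nat.add_sub_cancel, take_rleStart_decodeRLE]
  rw [getD_decodeRLE_rleStart rS j (by omega) hS.1, decodeRLE_take_succ rS j (by omega),
    decodeRLE_take_succ rP (k + 1) (by omega)]
  refine append_replicate_suffix_append_replicate_iff ?_ hP_ne hS_ne
    (hS.1 _ (List.getElem_mem _)) (hP.1 _ (List.getElem_mem _))
  intro h
  simp [h] at hP_last
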